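/- For ε = 0, the rank-4 distribution on ℝ⁹ spanned by ζ₂, ζ₃, ζ₅, ζ₇ is involutive: for every pair i, j ∈ {2,3,5,7} and every point z ∈ ℝ⁹, the vector [ζᵢ, ζⱼ](z) lies in the linear span of ζ₂(z), ζ₃(z), ζ₅(z), ζ₇(z). (Explicitly, [ζ₂,ζ₃] = ζ₅, [ζ₂,ζ₅] = ζ₇, and [ζ₂,ζ₇] = [ζ₃,ζ₅] = [ζ₃,ζ₇] = [ζ₅,ζ₇] = 0 when ε = 0. This is the complete integrability of F⁽³⁾ in the C₃ model, giving rise to an Engel foliation on the prolongation.) -/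

import Mathlib

/- The prolongation of the ε-family on ℝ⁹ = ℝ⁷ × ℝ² with coordinates
(x, y, s, t, z, w, u, θ, φ), indexed by 0,…,8. Vector fields are identified
with maps ℝ⁹ → ℝ⁹ of their coefficients; ξ̂ᵢ is the lift of ξᵢ from ℝ⁷. -/

def xi1h (ε : ℝ) (p : Fin 9 → ℝ) : Fin 9 → ℝ :=
  ![1, 0, p 5 + ε * p 3, p 1, 0, 0, 0, 0, 0]
def xi2h (p : Fin 9 → ℝ) : Fin 9 → ℝ := ![0, 0, 0, 0, 1, 0, p 5, 0, 0]
def xi3h (ε : ℝ) (p : Fin 9 → ℝ) : Fin 9 → ℝ :=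
  ![0, 1, -(p 4 - ε * p 3), -p 0, 0, 0, 0, 0, 0]
def xi4h (p : Fin 9 → ℝ) : Fin 9 → ℝ := ![0, 0, 0, 0, 0, 1, -p 4, 0, 0]
def xi5h (ε : ℝ) (p : Fin 9 → ℝ) : Fin 9 → ℝ :=
  ![0, 0, ε * (p 0 + p 1), -2, 0, 0, 0, 0, 0]
def xi6h (_ : Fin 9 → ℝ) : Fin 9 → ℝ := ![0, 0, -1, 0, 0, 0, 0, 0, 0]
def xi7h (_ : Fin 9 → ℝ) : Fin 9 → ℝ := ![0, 0, 0, 0, 0, 0, -2, 0, 0]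

def zeta1 (_ : Fin 9 → ℝ) : Fin 9 → ℝ := ![0, 0, 0, 0, 0, 0, 0, 1, 0]
def zeta2 (ε : ℝ) (p : Fin 9 → ℝ) : Fin 9 → ℝ :=
  xi1h ε p + p 7 • xi2h p + p 8 • xi3h ε p + (p 7 * p 8) • xi4h p
def zeta3 (_ : Fin 9 → ℝ) : Fin 9 → ℝ := ![0, 0, 0, 0, 0, 0, 0, 0, 1]
def zeta4 (p : Fin 9 → ℝ) : Fin 9 → ℝ := xi2h p + p 8 • xi4h p
def zeta5 (ε : ℝ) (p : Fin 9 → ℝ) : Fin 9 → ℝ := -xi3h ε p - p 7 • xi4h p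
def zeta6 (p : Fin 9 → ℝ) : Fin 9 → ℝ := -xi4h p
def zeta7 (ε : ℝ) (p : Fin 9 → ℝ) : Fin 9 → ℝ :=
  -(xi5h ε p + (2 * p 7) • xi6h p + (p 7 ^ 2) • xi7h p)
def zeta8 (p : Fin 9 → ℝ) : Fin 9 → ℝ := -(xi6h p + p 7 • xi7h p)
def zeta9 (p : Fin 9 → ℝ) : Fin 9 → ℝ := -xi7h p

theorem zeta2_zero_eq (p : Fin 9 → ℝ) :
    zeta2 0 p = ![1, p 8, p 5 - p 8 * p 4, p 1 - p 8 * p 0, p 7, p 7 * p 8,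
      p 7 * p 5 - p 7 * p 8 * p 4, 0, 0] := by
  ext k
  fin_cases k <;> simp [zeta2, xi1h, xi2h, xi3h, xi4h] <;> ring

theorem zeta5_zero_eq (p : Fin 9 → ℝ) :
    zeta5 0 p = ![0, -1, p 4, p 0, 0, -p 7, p 7 * p 4, 0, 0] := by
  ext k
  fin_cases k <;> simp [zeta5, xi3h, xi4h]

theorem zeta7_zero_eq (p : Fin 9 → ℝ) :
    zeta7 0 p = ![0, 0, 2 * p 7, 2, 0, 0, 2 * p 7 ^ 2, 0, 0] := by
  ext k
  fin_cases k <;> simp [zeta7, xi5h, xi6h, xi7h, mul_comm]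

/-- The coordinatewise derivative of a vector field along a line determines its Fréchet
derivative in that direction. -/
theorem fderiv_eq_of_hasDerivAt_line {V : (Fin 9 → ℝ) → Fin 9 → ℝ} {z v w : Fin 9 → ℝ}
    (hV : DifferentiableAt ℝ V z)
    (h : ∀ k, HasDerivAt (fun t : ℝ => V (z + t • v) k) (w k) 0) :
    fderiv ℝ V z v = w := by
  rw [← hV.lineDeriv_eq_fderiv]
  exact (hasDerivAt_pi.2 h).deriv

theorem hasDerivAt_coord_line (z v : Fin 9 → ℝ) (k : Fin 9) :
    HasDerivAt (fun t : ℝ => z k + t * v k) (v k) 0 := by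
  simpa using ((hasDerivAt_id (0 : ℝ)).mul_const (v k)).const_add (z k)

theorem fderiv_zeta2_zero (z v : Fin 9 → ℝ) :
    fderiv ℝ (zeta2 0) z v =
      ![0, v 8, v 5 - (v 8 * z 4 + z 8 * v 4), v 1 - (v 8 * z 0 + z 8 * v 0), v 7,
        v 7 * z 8 + z 7 * v 8,
        v 7 * z 5 + z 7 * v 5 - ((v 7 * z 8 + z 7 * v 8) * z 4 + z 7 * z 8 * v 4), 0, 0] := by
  have hc := hasDerivAt_coord_line z v
  rw [funext zeta2_zero_eq]
  refine fderiv_eq_of_hasDerivAt_line ?_ fun k => ?_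
  · refine differentiableAt_pi.2 fun k => ?_
    fin_cases k <;> simp <;> fun_prop
  · fin_cases k <;> simp [-hasDerivAt_const_add_iff]
    · exact hasDerivAt_const _ _
    · exact hc 8
    · simpa using (hc 5).fun_sub ((hc 8).fun_mul (hc 4))
    · simpa using (hc 1).fun_sub ((hc 8).fun_mul (hc 0))
    · exact hc 7
    · simpa using (hc 7).fun_mul (hc 8)
    · simpa using ((hc 7).fun_mul (hc 5)).fun_sub (((hc 7).fun_mul (hc 8)).fun_mul (hc 4))
    · exact hasDerivAt_const _ _
    · exact hasDerivAt_const _ _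

theorem fderiv_zeta3 (z v : Fin 9 → ℝ) : fderiv ℝ zeta3 z v = 0 := by
  simp [show zeta3 = fun _ => ![0, 0, 0, 0, 0, 0, 0, 0, 1] from rfl]

theorem fderiv_zeta5_zero (z v : Fin 9 → ℝ) :
    fderiv ℝ (zeta5 0) z v =
      ![0, 0, v 4, v 0, 0, -v 7, v 7 * z 4 + z 7 * v 4, 0, 0] := by
  have hc := hasDerivAt_coord_line z v
  rw [funext zeta5_zero_eq]
  refine fderiv_eq_of_hasDerivAt_line ?_ fun k => ?_
  · refine differentiableAt_pi.2 fun k => ?_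
    fin_cases k <;> simp <;> fun_prop
  · fin_cases k <;> simp [-hasDerivAt_const_add_iff]
    · exact hasDerivAt_const _ _
    · exact hasDerivAt_const _ _
    · exact hc 4
    · exact hc 0
    · exact hasDerivAt_const _ _
    · simpa using (hc 7).fun_neg
    · simpa using (hc 7).fun_mul (hc 4)
    · exact hasDerivAt_const _ _
    · exact hasDerivAt_const _ _

theorem fderiv_zeta7_zero (z v : Fin 9 → ℝ) :
    fderiv ℝ (zeta7 0) z v = ![0, 0, 2 * v 7, 0, 0, 0, 4 * z 7 * v 7, 0, 0] := by
  have hc := hasDerivAt_coord_line z v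
  rw [funext zeta7_zero_eq]
  refine fderiv_eq_of_hasDerivAt_line ?_ fun k => ?_
  · refine differentiableAt_pi.2 fun k => ?_
    fin_cases k <;> simp <;> fun_prop
  · fin_cases k <;> simp [-hasDerivAt_const_add_iff]
    · exact hasDerivAt_const _ _
    · exact hasDerivAt_const _ _
    · exact (hc 7).const_mul 2
    · exact hasDerivAt_const _ _
    · exact hasDerivAt_const _ _
    · exact hasDerivAt_const _ _
    · refine (((hc 7).fun_pow 2).const_mul 2).congr_deriv ?_
      simp
      ring
    · exact hasDerivAt_const _ _
    · exact hasDerivAt_const _ _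

open VectorField

theorem lieBracket_zeta2_zeta3 (z : Fin 9 → ℝ) :
    lieBracket ℝ (zeta2 0) zeta3 z = zeta5 0 z := by
  rw [lieBracket, fderiv_zeta2_zero, fderiv_zeta3]
  ext k
  fin_cases k <;> simp [zeta5_zero_eq, zeta3]

theorem lieBracket_zeta2_zeta5 (z : Fin 9 → ℝ) :
    lieBracket ℝ (zeta2 0) (zeta5 0) z = zeta7 0 z := by
  rw [lieBracket, fderiv_zeta2_zero, fderiv_zeta5_zero]
  ext k
  fin_cases k <;> simp [zeta2_zero_eq, zeta5_zero_eq, zeta7_zero_eq] <;> ring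

theorem lieBracket_zeta2_zeta7 (z : Fin 9 → ℝ) :
    lieBracket ℝ (zeta2 0) (zeta7 0) z = 0 := by
  rw [lieBracket, fderiv_zeta2_zero, fderiv_zeta7_zero]
  ext k
  fin_cases k <;> simp [zeta2_zero_eq, zeta7_zero_eq]

theorem lieBracket_zeta3_zeta5 (z : Fin 9 → ℝ) :
    lieBracket ℝ zeta3 (zeta5 0) z = 0 := by
  rw [lieBracket, fderiv_zeta3, fderiv_zeta5_zero]
  ext k
  fin_cases k <;> simp [zeta3]

theorem lieBracket_zeta3_zeta7 (z : Fin 9 → ℝ) :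
    lieBracket ℝ zeta3 (zeta7 0) z = 0 := by
  rw [lieBracket, fderiv_zeta3, fderiv_zeta7_zero]
  ext k
  fin_cases k <;> simp [zeta3]

theorem lieBracket_zeta5_zeta7 (z : Fin 9 → ℝ) :
    lieBracket ℝ (zeta5 0) (zeta7 0) z = 0 := by
  rw [lieBracket, fderiv_zeta5_zero, fderiv_zeta7_zero]
  ext k
  fin_cases k <;> simp [zeta5_zero_eq, zeta7_zero_eq]

/-- For ε = 0, the rank-4 distribution on ℝ⁹ spanned by ζ₂, ζ₃, ζ₅, ζ₇ is
involutive: every bracket [ζᵢ,ζⱼ] (i,j ∈ {2,3,5,7}) lies pointwise in the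
span of ζ₂, ζ₃, ζ₅, ζ₇. This is the complete integrability of F⁽³⁾ in the C₃
model, giving rise to an Engel foliation on the prolongation. -/
theorem engel_foliation_involutive :
    ∀ (i j : Fin 4) (z : Fin 9 → ℝ),
      VectorField.lieBracket ℝ
          (![zeta2 0, zeta3, zeta5 0, zeta7 0] i)
          (![zeta2 0, zeta3, zeta5 0, zeta7 0] j) z ∈
        Submodule.span ℝ
          ({zeta2 0 z, zeta3 z, zeta5 0 z, zeta7 0 z} : Set (Fin 9 → ℝ)) := by
  intro i j z
  have h5 : zeta5 0 z ∈ Submodule.span ℝ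
      ({zeta2 0 z, zeta3 z, zeta5 0 z, zeta7 0 z} : Set (Fin 9 → ℝ)) :=
    Submodule.subset_span (by simp)
  have h7 : zeta7 0 z ∈ Submodule.span ℝ
      ({zeta2 0 z, zeta3 z, zeta5 0 z, zeta7 0 z} : Set (Fin 9 → ℝ)) :=
    Submodule.subset_span (by simp)
  wlog hij : i ≤ j generalizing i j
  · rw [lieBracket_swap]
    exact Submodule.neg_mem _ (this j i (le_of_not_ge hij))
  fin_cases i <;> fin_cases j <;>
    first
    | exact absurd hij (by decide)
    | simp [lieBracket_zeta2_zeta3, lieBracket_zeta2_zeta5, lieBracket_zeta2_zeta7,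
        lieBracket_zeta3_zeta5, lieBracket_zeta3_zeta7, lieBracket_zeta5_zeta7, h5, h7]
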